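/- arXiv:1903.12315 — 2 statements merged into one kernel-verified Lean document; each statement's English description precedes it below -/
import Mathlib

section
/- Let α ∈ (0,1), δ ∈ (-1,1), and let p be the density of Z ~ S_α(δ). Then for every 0 < β < α there is a constant C_{α,β} > 0 such that for every h ∈ H_β and every a > 0, |∫_ℝ (L^{α,δ} p)(y) h(ay) dy| ≤ C_{α,β} a^α. -/
open MeasureTheory Real Filter Set
open scoped Topology

noncomputable section

/-- Normalizing constant `d_α`. -/
def dconst (α : ℝ) : ℝ :=
  if α = 1 then 2 / π else -1 / (Real.Gamma (-α) * Real.cos (π * α / 2))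

/-- Density of the Lévy measure `ν_{α,δ}` with respect to Lebesgue measure. -/
def nuDens (α δ : ℝ) (u : ℝ) : ℝ :=
  dconst α * (if 0 < u then (1 + δ) / 2 * u ^ (-1 - α)
    else if u < 0 then (1 - δ) / 2 * |u| ^ (-1 - α) else 0)

/-- Generator `L^{α,δ}` for `α ∈ (0,1)`. -/
def Lop (α δ : ℝ) (f : ℝ → ℝ) (x : ℝ) : ℝ :=
  ∫ u, (f (x + u) - f x) * nuDens α δ u

/-- Generator `L^{1,0}` (note `ν_{1,0}(du) = (2/π)|u|⁻²/2 du = 1/(π u²) du`). -/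
def Lop1 (f : ℝ → ℝ) (x : ℝ) : ℝ :=
  ∫ u, (f (x + u) - f x - (if |u| ≤ 1 then u * deriv f x else 0)) * (1 / (π * u ^ 2))

/-- Combined generator. -/
def LopA (α δ : ℝ) (f : ℝ → ℝ) (x : ℝ) : ℝ :=
  if α = 1 then Lop1 f x else Lop α δ f x

/-- Characteristic function of the strictly `α`-stable law at time `t`. -/
def stableCF (α δ t l : ℝ) : ℂ :=
  if α = 1 then Complex.exp (↑(-(t * |l|)) : ℂ)
  else Complex.exp ((↑(-(t * |l| ^ α)) : ℂ) *
    (1 - Complex.I * (δ : ℂ) * ((Real.sign l : ℝ) : ℂ) * ((Real.tan (π * α / 2) : ℝ) : ℂ)))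

/-- `μ` is the strictly `α`-stable law `S_α(δ)`. -/
def IsStableLaw (α δ : ℝ) (μ : Measure ℝ) : Prop :=
  ∀ l : ℝ, (∫ x, Complex.exp (Complex.I * (l : ℂ) * (x : ℂ)) ∂μ) = stableCF α δ 1 l

/-- The class `H_β`. -/
def memHbeta (β : ℝ) (h : ℝ → ℝ) : Prop :=
  ∀ x y : ℝ, |h x - h y| ≤ min |x - y| (|x - y| ^ β)

/-- The distance `d_{W_β}`. -/
def dWbeta (β : ℝ) (μ ν : Measure ℝ) : ℝ :=
  sSup { r | ∃ h : ℝ → ℝ, memHbeta β h ∧ r = |(∫ x, h x ∂μ) - ∫ x, h x ∂ν| }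

/-- The Kolmogorov distance. -/
def dKol (μ ν : Measure ℝ) : ℝ :=
  sSup { r | ∃ x : ℝ, r = |(μ (Set.Iic x)).toReal - (ν (Set.Iic x)).toReal| }

/-- The solution of Stein's equation. -/
def steinSol (α : ℝ) (p h : ℝ → ℝ) (x : ℝ) : ℝ :=
  -∫ t in Set.Ioi (0:ℝ), ∫ y, p y *
    (h ((1 - Real.exp (-t)) ^ (1/α) * y + Real.exp (-t/α) * x) - h y)


lemma aux_intExp {α s : ℝ} (hα : 0 < α) (hs : -1 < s) :
    IntegrableOn (fun x : ℝ => x ^ s * Real.exp (-x ^ α)) (Ioi 0) := by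
  by_contra h
  have h1 := integral_rpow_mul_exp_neg_rpow hα hs
  rw [integral_undef h] at h1
  have : 0 < 1 / α * Real.Gamma ((s + 1) / α) :=
    mul_pos (by positivity) (Real.Gamma_pos_of_pos (div_pos (by linarith) hα))
  linarith

lemma aux_integrable_abs {f : ℝ → ℝ} (hf : IntegrableOn f (Ioi 0)) :
    Integrable (fun x : ℝ => f |x|) := by
  rw [← integrableOn_univ, ← Iic_union_Ioi (a := (0 : ℝ))]
  refine IntegrableOn.union ?_ ?_
  · have h : IntegrableOn (fun x => f (-x)) (Iic 0) := by
      have := (integrableOn_Ici_iff_integrableOn_Ioi (f := f) (b := (0:ℝ)) (μ := volume)).2 hf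
      have h2 := this.comp_neg
      simpa using h2
    refine h.congr_fun (fun x hx => ?_) measurableSet_Iic
    simp only [mem_Iic] at hx
    simp [abs_of_nonpos hx]
  · refine hf.congr_fun (fun x hx => ?_) measurableSet_Ioi
    simp only [mem_Ioi] at hx
    simp [abs_of_pos hx]

lemma aux_norm_exp {c : ℂ} (hc : c.re = 1) (r : ℝ) :
    ‖Complex.exp (-c * (r : ℂ))‖ = Real.exp (-r) := by
  rw [Complex.norm_exp]; simp [hc]

lemma aux_norm_osc (x l : ℝ) : ‖Complex.exp (Complex.I * x * l)‖ = 1 := by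
  rw [Complex.norm_exp]; simp

/-- decay of the half-line oscillatory integral -/
lemma aux_J {α : ℝ} (hα : 0 < α) (c : ℂ) (hc : c.re = 1) :
    ∃ K : ℝ, 0 ≤ K ∧ ∀ x : ℝ, ‖∫ l in Ioi (0:ℝ), (l : ℂ) * Complex.exp (-c * ((l ^ α : ℝ) : ℂ)) *
      Complex.exp (Complex.I * x * l)‖ ≤ K / (1 + x ^ 2) := by
  set E : ℝ → ℂ := fun l => Complex.exp (-c * ((l ^ α : ℝ) : ℂ)) with hE
  set G2 : ℝ → ℂ := fun l => (-(c * α ^ 2 + c * α) * ((l ^ (α - 1) : ℝ) : ℂ)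
      + c ^ 2 * α ^ 2 * ((l ^ (2 * α - 1) : ℝ) : ℂ)) * E l with hG2
  have hEn : ∀ l, ‖E l‖ = Real.exp (-l ^ α) := fun l => aux_norm_exp hc _
  have hEm : Measurable E := by fun_prop
  have hGi : IntegrableOn (fun l : ℝ => (l : ℂ) * E l) (Ioi 0) := by
    refine Integrable.mono' (aux_intExp hα (s := 1) (by norm_num)) (by fun_prop) ?_
    filter_upwards [ae_restrict_mem measurableSet_Ioi] with l hl
    simp only [mem_Ioi] at hl
    rw [norm_mul, hEn]; simp [abs_of_pos hl]
  have hG1 : IntegrableOn (fun l : ℝ => ((l ^ (α - 1) : ℝ) : ℂ) * E l) (Ioi 0) := by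
    refine Integrable.mono' (aux_intExp hα (s := α - 1) (by linarith)) (by fun_prop) ?_
    filter_upwards [ae_restrict_mem measurableSet_Ioi] with l hl
    simp only [mem_Ioi] at hl
    rw [norm_mul, hEn, Complex.norm_real, Real.norm_of_nonneg (by positivity)]
  have hG1' : IntegrableOn (fun l : ℝ => ((l ^ (2 * α - 1) : ℝ) : ℂ) * E l) (Ioi 0) := by
    refine Integrable.mono' (aux_intExp hα (s := 2 * α - 1) (by linarith)) (by fun_prop) ?_
    filter_upwards [ae_restrict_mem measurableSet_Ioi] with l hl
    simp only [mem_Ioi] at hl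
    rw [norm_mul, hEn, Complex.norm_real, Real.norm_of_nonneg (by positivity)]
  have hE0 : IntegrableOn E (Ioi 0) := by
    refine Integrable.mono' (aux_intExp hα (s := 0) (by norm_num)) (by fun_prop) ?_
    filter_upwards with l
    rw [hEn]; simp
  have hEa : IntegrableOn (fun l : ℝ => ((l ^ α : ℝ) : ℂ) * E l) (Ioi 0) := by
    refine Integrable.mono' (aux_intExp hα (s := α) (by linarith)) (by fun_prop) ?_
    filter_upwards [ae_restrict_mem measurableSet_Ioi] with l hl
    simp only [mem_Ioi] at hl
    rw [norm_mul, hEn, Complex.norm_real, Real.norm_of_nonneg (by positivity)]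
  have hG2i : IntegrableOn G2 (Ioi 0) := by
    have := (hG1.const_mul (-(c * α ^ 2 + c * α))).add (hG1'.const_mul (c ^ 2 * α ^ 2))
    refine this.congr (ae_of_all _ fun l => ?_)
    simp only [hG2, Pi.add_apply]; ring
  have hosc : ∀ (x : ℝ) {F : ℝ → ℂ}, IntegrableOn F (Ioi 0) →
      IntegrableOn (fun l : ℝ => F l * Complex.exp (Complex.I * x * l)) (Ioi 0) := by
    intro x F hF
    refine Integrable.mono hF ?_ (ae_of_all _ fun l => ?_)
    · exact hF.aestronglyMeasurable.mul (by fun_prop)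
    · rw [norm_mul, aux_norm_osc, mul_one]
  have hoscn : ∀ (x : ℝ) (F : ℝ → ℂ),
      ‖∫ l in Ioi (0:ℝ), F l * Complex.exp (Complex.I * x * l)‖ ≤ ∫ l in Ioi (0:ℝ), ‖F l‖ := by
    intro x F
    refine (norm_integral_le_integral_norm _).trans (le_of_eq ?_)
    congr 1 with l
    rw [norm_mul, aux_norm_osc, mul_one]
  set K1 := ∫ l in Ioi (0:ℝ), ‖(l : ℂ) * E l‖
  set K2 := ∫ l in Ioi (0:ℝ), ‖G2 l‖
  have hK1 : 0 ≤ K1 := integral_nonneg fun _ => norm_nonneg _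
  have hK2 : 0 ≤ K2 := integral_nonneg fun _ => norm_nonneg _
  refine ⟨K1 + K2 + 1, by positivity, fun x => ?_⟩
  rw [le_div_iff₀ (by positivity)]
  set J := ∫ l in Ioi (0:ℝ), (l : ℂ) * E l * Complex.exp (Complex.I * x * l) with hJ
  have hJ1 : ‖J‖ ≤ K1 := hoscn x _
  have key : (x:ℂ) ^ 2 * J + ∫ l in Ioi (0:ℝ), G2 l * Complex.exp (Complex.I * x * l) = 0 - 1 := by
    rw [hJ, ← integral_const_mul, ← integral_add ((hosc x hGi).const_mul _) (hosc x hG2i)]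
    have hd : ∀ l ∈ Ioi (0:ℝ), HasDerivAt (fun l : ℝ =>
        (-(Complex.I * x * l) + (1 - c * α * ((l ^ α : ℝ) : ℂ))) * E l * Complex.exp (Complex.I * x * l))
        ((x:ℂ) ^ 2 * ((l : ℂ) * E l * Complex.exp (Complex.I * x * l)) +
          G2 l * Complex.exp (Complex.I * x * l)) l := by
      intro l hl
      simp only [mem_Ioi] at hl
      have hp : HasDerivAt (fun l : ℝ => ((l ^ α : ℝ) : ℂ)) ((α * l ^ (α - 1) : ℝ) : ℂ) l :=
        (Real.hasDerivAt_rpow_const (Or.inl hl.ne')).ofReal_comp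
      have hid : HasDerivAt (fun l : ℝ => (l : ℂ)) 1 l := Complex.ofRealCLM.hasDerivAt
      have h1 := ((hid.const_mul (Complex.I * x)).neg.add ((hp.const_mul (c * α)).const_sub 1))
      have h2 := (hp.const_mul (-c)).cexp
      have h3 := (hid.const_mul (Complex.I * x)).cexp
      refine ((h1.mul h2).mul h3).congr_deriv ?_
      have e1 : ((l ^ (2 * α - 1) : ℝ) : ℂ) = ((l ^ α : ℝ) : ℂ) * ((l ^ (α - 1) : ℝ) : ℂ) := by
        rw [← Complex.ofReal_mul, ← Real.rpow_add hl]; ring_nf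
      have e2 : ((l ^ α : ℝ) : ℂ) = l * ((l ^ (α - 1) : ℝ) : ℂ) := by
        rw [← Complex.ofReal_mul, Real.rpow_sub_one hl.ne']; congr 1; field_simp
      simp only [hG2, hE, e1, Pi.add_apply, Pi.mul_apply, Pi.neg_apply]
      simp only [e2]
      push_cast
      linear_combination (-(x:ℂ)^2 * l * Complex.exp (-c * (l * ((l ^ (α - 1) : ℝ) : ℂ))) * Complex.exp (Complex.I * x * l)) * Complex.I_sq
    have hli : Tendsto (fun l : ℝ =>
        (-(Complex.I * x * l) + (1 - c * α * ((l ^ α : ℝ) : ℂ))) * E l * Complex.exp (Complex.I * x * l)) atTop (𝓝 0) := by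
      refine tendsto_zero_of_hasDerivAt_of_integrableOn_Ioi hd
        (((hosc x hGi).const_mul _).add (hosc x hG2i)) (hosc x ?_)
      have := ((hGi.const_mul (-(Complex.I * x))).add hE0).sub (hEa.const_mul (c * α))
      refine this.congr (ae_of_all _ fun l => ?_)
      simp only [Pi.add_apply, Pi.sub_apply]; ring
    rw [integral_Ioi_of_hasDerivAt_of_tendsto ?_ hd
      (((hosc x hGi).const_mul _).add (hosc x hG2i)) hli]
    · simp [hE, Real.zero_rpow hα.ne']
    · apply Continuous.continuousWithinAt
      have : Continuous (fun l : ℝ => l ^ α) := Real.continuous_rpow_const hα.le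
      fun_prop
  have h4 : (x:ℂ) ^ 2 * J = - 1 - ∫ l in Ioi (0:ℝ), G2 l * Complex.exp (Complex.I * x * l) := by
    linear_combination key
  have h5 : x ^ 2 * ‖J‖ ≤ 1 + K2 := by
    have : x ^ 2 * ‖J‖ = ‖(x:ℂ) ^ 2 * J‖ := by simp
    rw [this, h4]
    refine (norm_sub_le _ _).trans ?_
    have := hoscn x G2
    simp only [norm_neg, norm_one]; linarith
  nlinarith

lemma aux_split {s t : ℝ} (M : ℝ) (hs : -1 < s) (ht : t < -1) :
    IntegrableOn (fun x : ℝ => if x ≤ 1 then x ^ s else M * x ^ t) (Ioi 0) := by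
  rw [← Ioc_union_Ioi_eq_Ioi (zero_le_one (α := ℝ))]
  refine IntegrableOn.union ?_ ?_
  · have h := (intervalIntegral.intervalIntegrable_rpow' (a := 0) (b := 1) hs)
    rw [intervalIntegrable_iff_integrableOn_Ioc_of_le zero_le_one] at h
    refine h.congr_fun (fun x hx => ?_) measurableSet_Ioc
    simp [hx.2]
  · have h := (integrableOn_Ioi_rpow_of_lt ht one_pos).const_mul M
    refine IntegrableOn.congr_fun h (fun x hx => ?_) measurableSet_Ioi
    simp only [mem_Ioi] at hx
    simp [not_le.2 hx]

lemma aux_kappa {α β : ℝ} (hα1 : α < 1) (hβ : β < α) :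
    Integrable (fun u : ℝ => min |u| (|u| ^ β) * |u| ^ (-1 - α)) := by
  refine aux_integrable_abs (f := fun u => min u (u ^ β) * u ^ (-1 - α)) ?_
  refine (aux_split (s := -α) (t := β + (-1 - α)) 1 (by linarith) (by linarith)).congr_fun
    (fun x hx => ?_) measurableSet_Ioi
  simp only [mem_Ioi] at hx
  have hβ1 : β ≤ 1 := by linarith
  simp only
  split_ifs with h
  · have h1 : x ≤ x ^ β := by
      simpa using Real.rpow_le_rpow_of_exponent_ge hx h hβ1
    have : x * x ^ (-1 - α) = x ^ (1 + (-1 - α)) := by rw [Real.rpow_add hx, Real.rpow_one]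
    rw [min_eq_left h1, this]; ring_nf
  · have h1 : x ^ β ≤ x := by
      simpa using Real.rpow_le_rpow_of_exponent_le (not_le.1 h).le hβ1
    rw [min_eq_right h1, Real.rpow_add hx, one_mul]

lemma aux_q {β : ℝ} (hβ0 : 0 < β) (hβ : β < 1) :
    Integrable (fun x : ℝ => (1 + |x| ^ β) / (1 + x ^ 2)) := by
  have h := (aux_integrable_abs (aux_split (s := 0) (t := β - 2) 1 (by linarith) (by linarith))).const_mul 2
  refine h.mono' (Measurable.aestronglyMeasurable (by fun_prop)) (ae_of_all _ fun x => ?_)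
  rw [Real.norm_of_nonneg (by positivity), ← sq_abs]
  generalize hy : |x| = y
  have hy0 : 0 ≤ y := hy ▸ abs_nonneg x
  rw [div_le_iff₀ (by positivity)]
  split_ifs with h1
  · have : y ^ β ≤ 1 := Real.rpow_le_one hy0 h1 hβ0.le
    simp; nlinarith
  · have hy1 : 1 < y := not_le.1 h1
    have h2 : 1 ≤ y ^ β := Real.one_le_rpow hy1.le hβ0.le
    have h3 : y ^ (β - 2) * y ^ 2 = y ^ β := by
      rw [← Real.rpow_natCast, ← Real.rpow_add (by linarith)]; norm_num
    have h4 : 0 ≤ y ^ (β - 2) := by positivity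
    nlinarith

lemma aux_exp_sub_one {w : ℂ} (hw : w.re ≤ 0) : ‖1 - Complex.exp w‖ ≤ 2 * ‖w‖ := by
  by_cases h : ‖w‖ ≤ 1
  · rw [norm_sub_rev]; exact Complex.norm_exp_sub_one_le h
  · have h1 : ‖Complex.exp w‖ ≤ 1 := by
      rw [Complex.norm_exp]; exact Real.exp_le_one_iff.2 hw
    have := norm_sub_le 1 (Complex.exp w)
    rw [norm_one] at this
    linarith

lemma aux_CF_pos {α δ l : ℝ} (hα1 : α < 1) (hl : 0 < l) :
    stableCF α δ 1 l =
      Complex.exp (-(1 - Complex.I * δ * (Real.tan (π * α / 2) : ℝ)) * ((l ^ α : ℝ) : ℂ)) := by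
  rw [stableCF, if_neg hα1.ne, Real.sign_of_pos hl, abs_of_pos hl]
  congr 1; push_cast; ring

lemma aux_CF_neg {α δ l : ℝ} (hα1 : α < 1) (hl : 0 < l) :
    stableCF α δ 1 (-l) =
      Complex.exp (-(1 + Complex.I * δ * (Real.tan (π * α / 2) : ℝ)) * ((l ^ α : ℝ) : ℂ)) := by
  rw [stableCF, if_neg hα1.ne, Real.sign_of_neg (by linarith), abs_neg, abs_of_pos hl]
  congr 1; push_cast; ring

lemma aux_CF_re {α δ l : ℝ} :
    ((↑(-(1 * |l| ^ α)) : ℂ) *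
    (1 - Complex.I * (δ : ℂ) * ((Real.sign l : ℝ) : ℂ) * ((Real.tan (π * α / 2) : ℝ) : ℂ))).re
      = - |l| ^ α := by
  rw [Complex.re_ofReal_mul]
  have : (1 - Complex.I * (δ : ℂ) * ((Real.sign l : ℝ) : ℂ) * ((Real.tan (π * α / 2) : ℝ) : ℂ)).re = 1 := by
    rw [show Complex.I * (δ : ℂ) * ((Real.sign l : ℝ) : ℂ) * ((Real.tan (π * α / 2) : ℝ) : ℂ)
      = Complex.I * ((δ * Real.sign l * Real.tan (π * α / 2) : ℝ) : ℂ) by push_cast; ring]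
    rw [Complex.sub_re, Complex.I_mul_re, Complex.ofReal_im]; simp
  rw [this]; ring

lemma aux_CF_norm {α δ l : ℝ} (hα1 : α < 1) : ‖stableCF α δ 1 l‖ = Real.exp (-|l| ^ α) := by
  rw [stableCF, if_neg hα1.ne, Complex.norm_exp, aux_CF_re]

lemma aux_CF_sub {α δ : ℝ} (hα1 : α < 1) : ∃ M : ℝ, 0 ≤ M ∧
    ∀ l, ‖1 - stableCF α δ 1 l‖ ≤ M * |l| ^ α := by
  refine ⟨2 * (1 + |δ| * |Real.tan (π * α / 2)|), by positivity, fun l => ?_⟩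
  rw [stableCF, if_neg hα1.ne]
  refine (aux_exp_sub_one ?_).trans ?_
  · rw [aux_CF_re]; have : 0 ≤ |l| ^ α := by positivity
    linarith
  · rw [norm_mul, Complex.norm_real, one_mul, norm_neg, Real.norm_of_nonneg (by positivity)]
    have h0 : 0 ≤ |l| ^ α := by positivity
    have hs : ‖((Real.sign l : ℝ) : ℂ)‖ ≤ 1 := by
      rcases Real.sign_apply_eq l with h | h | h <;> simp [h]
    have : ‖(1 - Complex.I * (δ : ℂ) * ((Real.sign l : ℝ) : ℂ) * ((Real.tan (π * α / 2) : ℝ) : ℂ))‖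
        ≤ 1 + |δ| * |Real.tan (π * α / 2)| := by
      refine (norm_sub_le _ _).trans ?_
      rw [norm_mul, norm_mul, norm_mul, norm_one, Complex.norm_I, Complex.norm_real, one_mul,
        Complex.norm_real (Real.tan _), Real.norm_eq_abs, Real.norm_eq_abs]
      have : |δ| * ‖((Real.sign l : ℝ) : ℂ)‖ ≤ |δ| * 1 := by gcongr
      rw [mul_one] at this
      gcongr
    nlinarith

lemma aux_tail {α δ : ℝ} (hα0 : 0 < α) (hα1 : α < 1) (μZ : Measure ℝ) [IsProbabilityMeasure μZ]
    (hZ : IsStableLaw α δ μZ) : ∃ M : ℝ, 0 ≤ M ∧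
    ∀ r : ℝ, 0 < r → μZ.real {x | r < |x|} ≤ M * r ^ (-α) := by
  obtain ⟨M, hM, hM'⟩ := aux_CF_sub (α := α) (δ := δ) hα1
  have hcf : ∀ t, charFun μZ t = stableCF α δ 1 t := by
    intro t
    rw [← hZ t, charFun_apply_real]
    congr 1 with x; congr 1; ring
  refine ⟨2 * M * 2 ^ α, by positivity, fun r hr => ?_⟩
  refine (measureReal_abs_gt_le_integral_charFun hr).trans ?_
  have : ‖∫ t in (-2 * r⁻¹)..(2 * r⁻¹), 1 - charFun μZ t‖ ≤ (M * (2 * r⁻¹) ^ α) * |2 * r⁻¹ - (-2 * r⁻¹)| := by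
    refine intervalIntegral.norm_integral_le_of_norm_le_const fun t ht => ?_
    rw [hcf]
    refine (hM' t).trans ?_
    have h0 : 0 ≤ r⁻¹ := by positivity
    rw [uIoc_of_le (by linarith)] at ht
    have : |t| ≤ 2 * r⁻¹ := abs_le.2 ⟨by linarith [ht.1], ht.2⟩
    gcongr
  calc _ ≤ 2⁻¹ * r * ((M * (2 * r⁻¹) ^ α) * |2 * r⁻¹ - (-2 * r⁻¹)|) := by gcongr
    _ = _ := by
      have h0 : 0 < r⁻¹ := by positivity
      rw [show 2 * r⁻¹ - (-2 * r⁻¹) = 4 * r⁻¹ by ring, abs_of_pos (by positivity),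
        Real.mul_rpow (by norm_num) h0.le, Real.inv_rpow hr.le, Real.rpow_neg hr.le]
      field_simp; ring

lemma aux_moment {α δ β : ℝ} (hα0 : 0 < α) (hα1 : α < 1) (μZ : Measure ℝ) [IsProbabilityMeasure μZ]
    (hZ : IsStableLaw α δ μZ) (hβ0 : 0 < β) (hβ : β < α) :
    ∫⁻ x, ENNReal.ofReal (|x| ^ β) ∂μZ < ⊤ := by
  obtain ⟨M, hM, hM'⟩ := aux_tail hα0 hα1 μZ hZ
  rw [lintegral_rpow_eq_lintegral_meas_lt_mul μZ (f := fun x => |x|) (ae_of_all _ fun x => abs_nonneg x)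
    (by fun_prop) hβ0]
  refine ENNReal.mul_lt_top ENNReal.ofReal_lt_top ?_
  have hi := (aux_split (s := β - 1) (t := -α + (β - 1)) M (by linarith) (by linarith))
  refine lt_of_le_of_lt (setLIntegral_mono' measurableSet_Ioi fun t ht => ?_) hi.lintegral_lt_top
  simp only [mem_Ioi] at ht
  have h1 : μZ {a | t < |a|} = ENNReal.ofReal (μZ.real {a | t < |a|}) := by simp
  rw [h1, ← ENNReal.ofReal_mul measureReal_nonneg]
  apply ENNReal.ofReal_le_ofReal
  have h0 : 0 ≤ t ^ (β - 1) := by positivity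
  split_ifs with h
  · have : μZ.real {a | t < |a|} ≤ 1 := measureReal_le_one
    nlinarith
  · rw [Real.rpow_add ht, ← mul_assoc]
    have := hM' t ht
    gcongr

lemma aux_p_int {μZ : Measure ℝ} [IsProbabilityMeasure μZ] {p : ℝ → ℝ} (hp0 : ∀ x, 0 ≤ p x) (hpc : Continuous p)
    (hpd : μZ = volume.withDensity fun x => ENNReal.ofReal (p x)) {g : ℝ → ℝ} (hg : Measurable g)
    (hg0 : ∀ x, 0 ≤ g x)
    (h : ∫⁻ x, ENNReal.ofReal (g x) ∂μZ < ⊤) : Integrable (fun x => p x * g x) := by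
  rw [hpd, lintegral_withDensity_eq_lintegral_mul _ (by fun_prop) (by fun_prop)] at h
  refine ⟨by fun_prop, ?_⟩
  rw [hasFiniteIntegral_iff_ofReal (ae_of_all _ fun x => mul_nonneg (hp0 x) (hg0 x))]
  simpa [ENNReal.ofReal_mul (hp0 _)] using h

lemma aux_p_integrable {μZ : Measure ℝ} [IsProbabilityMeasure μZ] {p : ℝ → ℝ} (hp0 : ∀ x, 0 ≤ p x) (hpc : Continuous p)
    (hpd : μZ = volume.withDensity fun x => ENNReal.ofReal (p x)) : Integrable p := by
  simpa using aux_p_int hp0 hpc hpd (g := fun _ => 1) (by fun_prop) (by simp) (by simp)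

lemma aux_p_integral {μZ : Measure ℝ} [IsProbabilityMeasure μZ] {p : ℝ → ℝ} (hp0 : ∀ x, 0 ≤ p x) (hpc : Continuous p)
    (hpd : μZ = volume.withDensity fun x => ENNReal.ofReal (p x)) : ∫ x, p x = 1 := by
  rw [integral_eq_lintegral_of_nonneg_ae (ae_of_all _ hp0) (by fun_prop)]
  have : μZ univ = 1 := measure_univ
  rw [hpd, withDensity_apply _ MeasurableSet.univ, setLIntegral_univ] at this
  simp [this]

lemma aux_CF_meas (α δ : ℝ) : Measurable (stableCF α δ 1) := by
  have hs : Measurable Real.sign := by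
    have : Real.sign = fun r : ℝ => if r < 0 then (-1:ℝ) else if 0 < r then 1 else 0 := by
      ext r; rfl
    rw [this]
    exact Measurable.ite measurableSet_Iio measurable_const
      (Measurable.ite measurableSet_Ioi measurable_const measurable_const)
  unfold stableCF
  split_ifs <;> fun_prop

lemma aux_CF_int {α δ s : ℝ} (hα0 : 0 < α) (hα1 : α < 1) (hs : -1 < s) :
    Integrable (fun l : ℝ => |l| ^ s * ‖stableCF α δ 1 l‖) := by
  simp_rw [aux_CF_norm hα1]
  exact aux_integrable_abs (aux_intExp hα0 hs)

lemma aux_inv {α δ : ℝ} (hα0 : 0 < α) (hα1 : α < 1)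
    (μZ : Measure ℝ) [IsProbabilityMeasure μZ] (hZ : IsStableLaw α δ μZ)
    {p : ℝ → ℝ} (hp0 : ∀ x, 0 ≤ p x) (hpc : Continuous p)
    (hpd : μZ = volume.withDensity fun x => ENNReal.ofReal (p x)) (x : ℝ) :
    (p x : ℂ) = ((2 * π)⁻¹ : ℝ) * ∫ l : ℝ, Complex.exp (-(Complex.I * x * l)) * stableCF α δ 1 l := by
  have hφi : Integrable (stableCF α δ 1) := by
    rw [← integrable_norm_iff (aux_CF_meas α δ).aestronglyMeasurable]
    simpa using aux_CF_int (δ := δ) hα0 hα1 (s := 0) (by norm_num)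
  have hF : FourierTransform.fourier (fun x : ℝ => (p x : ℂ)) = fun w => stableCF α δ 1 (-(2 * π) * w) := by
    ext w
    rw [← hZ, Real.fourier_real_eq_integral_exp_smul, hpd,
      integral_withDensity_eq_integral_toReal_smul (by fun_prop) (by simp)]
    congr 1 with v
    rw [ENNReal.toReal_ofReal (hp0 v), smul_eq_mul, Complex.real_smul, mul_comm]
    congr 2; push_cast; ring
  have hPi : Integrable (fun x : ℝ => (p x : ℂ)) := (aux_p_integrable hp0 hpc hpd).ofReal
  have h2 : -(2 * π) ≠ 0 := by have := Real.pi_pos; linarith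
  have hinv := hPi.fourierInv_fourier_eq (v := x) (by rw [hF]; exact hφi.comp_mul_left' h2)
    (by fun_prop)
  rw [← hinv, hF, Real.fourierInv_eq']
  have := Measure.integral_comp_mul_left
    (fun l : ℝ => Complex.exp (-(Complex.I * x * l)) * stableCF α δ 1 l) (-(2 * π))
  rw [inv_neg, abs_neg, abs_of_pos (by have := Real.pi_pos; positivity)] at this
  rw [← Complex.real_smul, ← this]
  congr 1 with v
  rw [smul_eq_mul]
  congr 2
  simp; ring

lemma aux_deriv {α δ : ℝ} (hα0 : 0 < α) (hα1 : α < 1)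
    (μZ : Measure ℝ) [IsProbabilityMeasure μZ] (hZ : IsStableLaw α δ μZ)
    {p : ℝ → ℝ} (hp0 : ∀ x, 0 ≤ p x) (hpc : Continuous p)
    (hpd : μZ = volume.withDensity fun x => ENNReal.ofReal (p x)) :
    ∃ K : ℝ, 0 ≤ K ∧ ∃ p' : ℝ → ℝ, ∀ x, HasDerivAt p (p' x) x ∧ |p' x| ≤ K / (1 + x ^ 2) := by
  set φ := stableCF α δ 1 with hφ
  have hφm : Measurable φ := aux_CF_meas α δ
  have hφi : Integrable φ := by
    rw [← integrable_norm_iff (aux_CF_meas α δ).aestronglyMeasurable]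
    simpa using aux_CF_int (δ := δ) hα0 hα1 (s := 0) (by norm_num)
  have hlφ : Integrable (fun l : ℝ => |l| * ‖φ l‖) := by
    simpa using aux_CF_int (δ := δ) hα0 hα1 (s := 1) (by norm_num)
  have hon : ∀ x l : ℝ, ‖Complex.exp (-(Complex.I * x * l))‖ = 1 := by
    intro x l
    rw [Complex.norm_exp]; simp
  set D : ℝ → ℝ → ℂ := fun x l => Complex.exp (-(Complex.I * x * l)) * (-(Complex.I * l)) * φ l with hD
  have hDn : ∀ x l, ‖D x l‖ = |l| * ‖φ l‖ := by
    intro x l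
    simp only [hD]
    rw [norm_mul, norm_mul, hon]; simp
  have hder : ∀ x : ℝ, HasDerivAt (fun x : ℝ => ∫ l : ℝ, Complex.exp (-(Complex.I * x * l)) * φ l)
      (∫ l, D x l) x := by
    intro x
    refine (hasDerivAt_integral_of_dominated_loc_of_deriv_le (s := univ) (bound := fun l => |l| * ‖φ l‖) univ_mem
      (Eventually.of_forall fun y => ?_) ?_ ?_ ?_ hlφ ?_).2
    · exact (Measurable.aestronglyMeasurable (by fun_prop))
    · refine hφi.mono (Measurable.aestronglyMeasurable (by fun_prop)) (ae_of_all _ fun l => ?_)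
      rw [norm_mul, hon, one_mul]
    · exact (Measurable.aestronglyMeasurable (by fun_prop))
    · exact ae_of_all _ fun l y _ => (hDn y l).le
    · refine ae_of_all _ fun l y _ => ?_
      have hid : HasDerivAt (fun l : ℝ => (l : ℂ)) 1 y := Complex.ofRealCLM.hasDerivAt
      refine ((((hid.const_mul Complex.I).mul_const (l:ℂ)).neg.cexp).mul_const (φ l)).congr_deriv ?_
      simp only [hD, Pi.neg_apply]; ring
  have hDi : ∀ x, Integrable (D x) := fun x =>
    hlφ.mono' (Measurable.aestronglyMeasurable (by fun_prop)) (ae_of_all _ fun l => (hDn x l).le)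
  have hpC : ∀ x, HasDerivAt (fun x => (p x : ℂ)) (((2 * π)⁻¹ : ℝ) * ∫ l, D x l) x := by
    intro x
    have := (hder x).const_mul (((2 * π)⁻¹ : ℝ) : ℂ)
    refine this.congr_of_eventuallyEq (Eventually.of_forall fun y => ?_)
    exact aux_inv hα0 hα1 μZ hZ hp0 hpc hpd y
  set T := Real.tan (π * α / 2) with hT
  obtain ⟨K1, hK1, hJ1⟩ := aux_J hα0 (1 - Complex.I * δ * T) (by
    rw [mul_assoc, Complex.sub_re, Complex.I_mul_re, ← Complex.ofReal_mul, Complex.ofReal_im]; simp)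
  obtain ⟨K2, hK2, hJ2⟩ := aux_J hα0 (1 + Complex.I * δ * T) (by
    rw [mul_assoc, Complex.add_re, Complex.I_mul_re, ← Complex.ofReal_mul, Complex.ofReal_im]; simp)
  have hDb : ∀ x, ‖∫ l, D x l‖ ≤ (K1 + K2) / (1 + x ^ 2) := by
    intro x
    rw [← intervalIntegral.integral_Iic_add_Ioi (b := 0) (hDi x).integrableOn (hDi x).integrableOn]
    have e1 : ∫ l in Ioi 0, D x l = -Complex.I * ∫ l in Ioi (0:ℝ), (l : ℂ) *
        Complex.exp (-(1 - Complex.I * δ * T) * ((l ^ α : ℝ) : ℂ)) * Complex.exp (Complex.I * ((-x : ℝ) : ℂ) * l) := by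
      rw [← integral_const_mul]
      refine setIntegral_congr_fun measurableSet_Ioi fun l hl => ?_
      simp only [hD, hφ]
      rw [aux_CF_pos hα1 hl, ← hT]
      push_cast
      ring_nf
    have e2 : ∫ l in Iic 0, D x l = Complex.I * ∫ l in Ioi (0:ℝ), (l : ℂ) *
        Complex.exp (-(1 + Complex.I * δ * T) * ((l ^ α : ℝ) : ℂ)) * Complex.exp (Complex.I * x * l) := by
      have := integral_comp_neg_Ioi 0 (D x)
      rw [neg_zero] at this
      rw [← this, ← integral_const_mul]
      refine setIntegral_congr_fun measurableSet_Ioi fun l hl => ?_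
      simp only [hD, hφ]
      rw [aux_CF_neg hα1 hl, ← hT]
      push_cast
      ring_nf
    rw [e1, e2]
    refine (norm_add_le _ _).trans ?_
    rw [norm_mul, norm_mul, norm_neg, Complex.norm_I, one_mul, one_mul, add_div, add_comm]
    have := hJ1 (-x)
    rw [neg_sq] at this
    exact add_le_add this (hJ2 x)
  refine ⟨(2 * π)⁻¹ * (K1 + K2), by have := Real.pi_pos; positivity,
    fun x => (((2 * π)⁻¹ : ℝ) * ∫ l, D x l : ℂ).re, fun x => ⟨?_, ?_⟩⟩
  · have := (Complex.reCLM.hasFDerivAt.comp_hasDerivAt x (hpC x))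
    simpa [Function.comp_def] using this
  · refine (Complex.abs_re_le_norm _).trans ?_
    have hpi := Real.pi_pos
    rw [norm_mul, Complex.norm_real, Real.norm_of_nonneg (by positivity), mul_div_assoc]
    gcongr
    exact hDb x

lemma aux_incr {p p' : ℝ → ℝ} {K : ℝ} (hK : 0 ≤ K)
    (hp' : ∀ x, HasDerivAt p (p' x) x ∧ |p' x| ≤ K / (1 + x ^ 2)) {x u : ℝ} (hu : |u| ≤ 1) :
    |p (x + u) - p x| ≤ 3 * K / (1 + x ^ 2) * |u| := by
  have hu' := abs_le.1 hu
  have h := (convex_Icc (x - 1) (x + 1)).norm_image_sub_le_of_norm_hasDerivWithin_le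
    (f := p) (f' := p') (C := 3 * K / (1 + x ^ 2)) (fun y _ => (hp' y).1.hasDerivWithinAt)
    (fun y hy => ?_) (x := x) (y := x + u) ⟨by linarith, by linarith⟩ ⟨by linarith, by linarith⟩
  · simpa using h
  · refine (hp' y).2.trans ?_
    rw [div_le_div_iff₀ (by positivity) (by positivity)]
    have h1 : 1 + x ^ 2 ≤ 3 * (1 + y ^ 2) := by
      have : (x - y) ^ 2 ≤ 1 := by
        have : |x - y| ≤ 1 := abs_le.2 ⟨by linarith [hy.2], by linarith [hy.1]⟩
        rw [← sq_abs]; nlinarith [abs_nonneg (x - y)]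
      nlinarith [sq_nonneg (x - 2 * y)]
    nlinarith

lemma aux_dom {p p' : ℝ → ℝ} {K β : ℝ} (hK : 0 ≤ K) (hβ0 : 0 < β) (hβ1 : β < 1) (hp0 : ∀ x, 0 ≤ p x)
    (hp' : ∀ x, HasDerivAt p (p' x) x ∧ |p' x| ≤ K / (1 + x ^ 2)) (x u : ℝ) :
    |p (x + u) - p x| * (1 + |x| ^ β) ≤ min |u| (|u| ^ β) *
      (3 * K * ((1 + |x| ^ β) / (1 + x ^ 2)) + 2 * (p (u + x) * (1 + |u + x| ^ β))
        + p x * (1 + |x| ^ β)) := by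
  have hx0 : 0 ≤ |x| ^ β := by positivity
  have hy0 : 0 ≤ |u + x| ^ β := by positivity
  have hr1 : 0 ≤ p (u + x) * (1 + |u + x| ^ β) := mul_nonneg (hp0 _) (by positivity)
  have hr2 : 0 ≤ p x * (1 + |x| ^ β) := mul_nonneg (hp0 _) (by positivity)
  by_cases hu : |u| ≤ 1
  · have hw : min |u| (|u| ^ β) = |u| := by
      apply min_eq_left
      rcases (abs_nonneg u).eq_or_lt with h | h
      · rw [← h]; positivity
      · simpa using Real.rpow_le_rpow_of_exponent_ge h hu hβ1.le
    rw [hw]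
    have h1 := aux_incr hK hp' (x := x) hu
    calc _ ≤ 3 * K / (1 + x ^ 2) * |u| * (1 + |x| ^ β) := by gcongr
      _ = |u| * (3 * K * ((1 + |x| ^ β) / (1 + x ^ 2))) := by ring
      _ ≤ _ := by
        apply mul_le_mul_of_nonneg_left _ (abs_nonneg u)
        linarith
  · have hu1 := (not_le.1 hu).le
    have hw : min |u| (|u| ^ β) = |u| ^ β := by
      apply min_eq_right
      simpa using Real.rpow_le_rpow_of_exponent_le hu1 hβ1.le
    rw [hw]
    have hw1 : 1 ≤ |u| ^ β := Real.one_le_rpow hu1 hβ0.le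
    have hq : 0 ≤ 3 * K * ((1 + |x| ^ β) / (1 + x ^ 2)) := by positivity
    have htri : |x| ^ β ≤ |u + x| ^ β + |u| ^ β := by
      have : |x| ≤ |u + x| + |u| := by
        have := abs_sub (u + x) u
        rwa [add_sub_cancel_left] at this
      exact (Real.rpow_le_rpow (abs_nonneg x) this hβ0.le).trans
        (Real.rpow_add_le_add_rpow (abs_nonneg _) (abs_nonneg _) hβ0.le hβ1.le)
    have h1 : |p (x + u) - p x| ≤ p (u + x) + p x := by
      rw [add_comm x u]
      exact abs_le.2 ⟨by linarith [hp0 (u + x), hp0 x], by linarith [hp0 (u + x), hp0 x]⟩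
    have h2 : p (u + x) * (1 + |x| ^ β) ≤ |u| ^ β * (2 * (p (u + x) * (1 + |u + x| ^ β))) := by
      have : 1 + |x| ^ β ≤ |u| ^ β * (2 * (1 + |u + x| ^ β)) := by nlinarith
      have := mul_le_mul_of_nonneg_left this (hp0 (u + x))
      linarith
    have h3 : p x * (1 + |x| ^ β) ≤ |u| ^ β * (p x * (1 + |x| ^ β)) := by nlinarith
    have h4 : 0 ≤ |u| ^ β * (3 * K * ((1 + |x| ^ β) / (1 + x ^ 2))) := by positivity
    have h5 : |p (x + u) - p x| * (1 + |x| ^ β) ≤ (p (u + x) + p x) * (1 + |x| ^ β) := by gcongr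
    linarith

lemma aux_nu {α δ : ℝ} (hδ : δ ∈ Set.Ioo (-1 : ℝ) 1) (u : ℝ) :
    |nuDens α δ u| ≤ |dconst α| * |u| ^ (-1 - α) := by
  unfold nuDens
  rw [abs_mul]
  gcongr
  have h0 : 0 ≤ |u| ^ (-1 - α) := by positivity
  obtain ⟨h1, h2⟩ := hδ
  split_ifs with h h'
  · rw [abs_of_pos h] at *
    rw [abs_of_nonneg (mul_nonneg (by linarith) h0)]; nlinarith
  · rw [abs_of_nonneg (mul_nonneg (by linarith) h0)]; nlinarith
  · simpa using h0

lemma aux_nu_meas (α δ : ℝ) : Measurable (nuDens α δ) := by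
  unfold nuDens
  refine measurable_const.mul (Measurable.ite measurableSet_Ioi (by fun_prop)
    (Measurable.ite measurableSet_Iio (by fun_prop) (by fun_prop)))

lemma aux_h_cont {β : ℝ} {h : ℝ → ℝ} (hh : memHbeta β h) : Continuous h := by
  have : LipschitzWith 1 h := LipschitzWith.of_dist_le_mul fun x y => by
    rw [Real.dist_eq, Real.dist_eq]; simpa using (hh x y).trans (min_le_left _ _)
  exact this.continuous

lemma aux_h_bound {β : ℝ} {h : ℝ → ℝ} (hh : memHbeta β h) {a : ℝ} (ha : 0 < a)
    (b y : ℝ) : |h (a * y + b)| ≤ (|h b| + a ^ β) * (1 + |y| ^ β) := by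
  have h1 := (hh (a * y + b) b).trans (min_le_right _ _)
  rw [add_sub_cancel_right, abs_mul, abs_of_pos ha, Real.mul_rpow ha.le (abs_nonneg y)] at h1
  have h2 : |h (a * y + b)| ≤ |h b| + |h (a * y + b) - h b| := by
    have := abs_add_le (h b) (h (a * y + b) - h b)
    rwa [add_sub_cancel] at this
  have h3 : 0 ≤ |y| ^ β := by positivity
  have h4 : 0 < a ^ β := by positivity
  nlinarith [abs_nonneg (h b)]

/-- Lemma 3.5 (1): `|∫ (L^{α,δ} p)(y) h(ay) dy| ≤ C_{α,β} a^α` for `α ∈ (0,1)`. -/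
theorem Lop_density_pairing_bound_lt_one
    (α δ : ℝ) (hα0 : 0 < α) (hα1 : α < 1) (hδ : δ ∈ Set.Ioo (-1 : ℝ) 1)
    (μZ : Measure ℝ) [IsProbabilityMeasure μZ] (hZ : IsStableLaw α δ μZ)
    (p : ℝ → ℝ) (hp0 : ∀ x, 0 ≤ p x) (hpc : Continuous p)
    (hpd : μZ = volume.withDensity fun x => ENNReal.ofReal (p x)) :
    ∀ β : ℝ, 0 < β → β < α → ∃ C > 0,
      ∀ h : ℝ → ℝ, memHbeta β h → ∀ a : ℝ, 0 < a →
        |∫ y, Lop α δ p y * h (a * y)| ≤ C * a ^ α := by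
  intro β hβ0 hβα
  have hβ1 : β < 1 := hβα.trans hα1
  obtain ⟨K, hK, p', hp'⟩ := aux_deriv hα0 hα1 μZ hZ hp0 hpc hpd
  set κ : ℝ → ℝ := fun u => min |u| (|u| ^ β) * |u| ^ (-1 - α) with hκ
  have hκi : Integrable κ := aux_kappa hα1 hβα
  have hκ0 : 0 ≤ ∫ u, κ u := integral_nonneg fun u => by simp only [hκ]; positivity
  have hpi := aux_p_integrable hp0 hpc hpd
  have hp1 := aux_p_integral hp0 hpc hpd
  set q : ℝ → ℝ := fun x => 3 * K * ((1 + |x| ^ β) / (1 + x ^ 2)) with hq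
  have hqi : Integrable q := (aux_q hβ0 hβ1).const_mul _
  set r : ℝ → ℝ := fun x => p x * (1 + |x| ^ β) with hr
  have hri : Integrable r := by
    have := hpi.add (aux_p_int hp0 hpc hpd (g := fun x => |x| ^ β) (by fun_prop) (fun x => by positivity)
      (aux_moment hα0 hα1 μZ hZ hβ0 hβα))
    refine this.congr (ae_of_all _ fun x => ?_)
    simp only [hr, Pi.add_apply]; ring
  refine ⟨|dconst α| * (∫ u, κ u) + 1, by positivity, fun h hh a ha => ?_⟩
  have hhc := aux_h_cont hh
  have hν := aux_nu_meas α δ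
  set F : ℝ → ℝ → ℝ := fun x u => (p (x + u) - p x) * nuDens α δ u * h (a * x) with hF
  have hFi : Integrable (Function.uncurry F) (volume.prod volume) := by
    have i1 : Integrable (fun z : ℝ × ℝ => q z.1 * κ z.2) (volume.prod volume) := hqi.mul_prod hκi
    have i2 : Integrable (fun z : ℝ × ℝ => r z.1 * κ z.2) (volume.prod volume) := hri.mul_prod hκi
    have i3 : Integrable (fun z : ℝ × ℝ => κ z.2 * r (z.2 + z.1)) (volume.prod volume) := by
      have hm := measurePreserving_prod_add_swap (volume : Measure ℝ) (volume : Measure ℝ)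
      exact (hm.integrable_comp (hκi.mul_prod hri).aestronglyMeasurable).2 (hκi.mul_prod hri)
    refine (((i1.add (i3.const_mul 2)).add i2).const_mul ((|h 0| + a ^ β) * |dconst α|)).mono'
      (Measurable.aestronglyMeasurable ?_) (ae_of_all _ fun z => ?_)
    · simp only [hF, Function.uncurry_def]
      fun_prop
    · obtain ⟨x, u⟩ := z
      simp only [hF, Function.uncurry_apply_pair, Pi.add_apply, Real.norm_eq_abs]
      rw [abs_mul, abs_mul]
      have hb := aux_h_bound hh ha 0 x
      rw [add_zero] at hb
      have hn := aux_nu (α := α) hδ u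
      have hd := aux_dom hK hβ0 hβ1 hp0 hp' x u
      have ha0 : 0 < a ^ β := by positivity
      calc _ ≤ |p (x + u) - p x| * (|dconst α| * |u| ^ (-1 - α)) * ((|h 0| + a ^ β) * (1 + |x| ^ β)) := by
            gcongr
        _ = (|h 0| + a ^ β) * |dconst α| * |u| ^ (-1 - α) * (|p (x + u) - p x| * (1 + |x| ^ β)) := by ring
        _ ≤ (|h 0| + a ^ β) * |dconst α| * |u| ^ (-1 - α) * _ := mul_le_mul_of_nonneg_left hd (by positivity)
        _ = _ := by simp only [hq, hr, hκ]; ring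
  have hswap : ∫ y, Lop α δ p y * h (a * y) = ∫ u, ∫ x, F x u := by
    rw [← integral_integral_swap hFi]
    congr 1 with x
    simp only [hF, Lop]
    rw [integral_mul_const]
  have hphi : ∀ b, Integrable (fun y => p y * h (a * y + b)) := by
    intro b
    refine (hri.const_mul (|h b| + a ^ β)).mono' (Continuous.aestronglyMeasurable (by fun_prop))
      (ae_of_all _ fun y => ?_)
    rw [norm_mul, Real.norm_of_nonneg (hp0 y), Real.norm_eq_abs]
    have := mul_le_mul_of_nonneg_left (aux_h_bound hh ha b y) (hp0 y)
    simp only [hr]; linarith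
  have hinner : ∀ u, ‖∫ x, F x u‖ ≤ |dconst α| * a ^ (1 + α) * κ (a * u) := by
    intro u
    have e1 : ∫ x, F x u = nuDens α δ u * ∫ x, p x * (h (a * x + -(a * u)) - h (a * x + 0)) := by
      have j1 := hphi (-(a * u))
      have j0 := hphi 0
      have j2 : Integrable (fun x => p (x + u) * h (a * x)) := by
        refine (j1.comp_add_right u).congr (ae_of_all _ fun x => ?_)
        simp only; congr 2; ring
      have j3 : Integrable (fun x => p x * h (a * x)) := by simpa using j0
      have s1 : ∫ x, p (x + u) * h (a * x) = ∫ x, p x * h (a * x + -(a * u)) := by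
        rw [← integral_add_right_eq_self (fun x => p x * h (a * x + -(a * u))) u]
        congr 1 with x; congr 2; ring
      have s2 : ∫ x, p x * (h (a * x + -(a * u)) - h (a * x + 0)) =
          (∫ x, p (x + u) * h (a * x)) - ∫ x, p x * h (a * x) := by
        simp only [mul_sub]
        rw [integral_sub j1 j0, s1]; simp
      rw [s2, ← integral_sub j2 j3, ← integral_const_mul]
      congr 1 with x
      simp only [hF]; ring
    rw [e1, norm_mul, Real.norm_eq_abs]
    have e2 : ‖∫ x, p x * (h (a * x + -(a * u)) - h (a * x + 0))‖ ≤ min |a * u| (|a * u| ^ β) := by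
      have := norm_integral_le_of_norm_le (μ := volume) (hpi.mul_const (min |a * u| (|a * u| ^ β)))
        (f := fun x => p x * (h (a * x + -(a * u)) - h (a * x + 0))) (ae_of_all _ fun x => ?_)
      · rwa [integral_mul_const, hp1, one_mul] at this
      · rw [norm_mul, Real.norm_of_nonneg (hp0 x), Real.norm_eq_abs]
        refine mul_le_mul_of_nonneg_left ?_ (hp0 x)
        have := hh (a * x + -(a * u)) (a * x + 0)
        rwa [show a * x + -(a * u) - (a * x + 0) = -(a * u) by ring, abs_neg] at this
    refine (mul_le_mul (aux_nu hδ u) e2 (norm_nonneg _) (by positivity)).trans (le_of_eq ?_)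
    simp only [hκ]
    have : |a * u| ^ (-1 - α) = (a ^ (1 + α))⁻¹ * |u| ^ (-1 - α) := by
      rw [abs_mul, abs_of_pos ha, Real.mul_rpow ha.le (abs_nonneg u), ← Real.rpow_neg ha.le]
      ring_nf
    rw [this]
    have h0 : a ^ (1 + α) ≠ 0 := by positivity
    field_simp
  rw [hswap, ← Real.norm_eq_abs]
  have hfin := norm_integral_le_of_norm_le (μ := volume)
    ((hκi.comp_mul_left' ha.ne').const_mul (|dconst α| * a ^ (1 + α)))
    (ae_of_all _ hinner)
  refine hfin.trans ?_
  rw [integral_const_mul, Measure.integral_comp_mul_left, abs_of_pos (inv_pos.2 ha), smul_eq_mul,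
    Real.rpow_add ha, Real.rpow_one]
  have hA : 0 < a ^ α := by positivity
  have : |dconst α| * (a * a ^ α) * (a⁻¹ * ∫ u, κ u) = |dconst α| * (∫ u, κ u) * a ^ α := by
    field_simp
  rw [this]
  linarith
end
end

section
/- Let α = 1, δ = 0, and let p be the density of the standard Cauchy law S_1(0). Then for every 0 < β < 1 there is a constant C_β > 0 such that for every h ∈ H_β and every a > 0, |∫_ℝ (L^{1,0} p)(y) h(ay) dy| ≤ C_β (a^β + a). -/
open MeasureTheory Real Filter Set
open scoped Topology

noncomputable section

/-- The standard Cauchy density. -/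
def cauchyDens (y : ℝ) : ℝ := 1 / (π * (1 + y ^ 2))

lemma tendsto_aux_div (l : Filter ℝ) (hl : Tendsto (fun u : ℝ => |u|) l atTop) :
    Tendsto (fun u : ℝ => u / (1 + u ^ 2)) l (𝓝 0) ∧
    Tendsto (fun u : ℝ => 1 / (1 + u ^ 2)) l (𝓝 0) := by
  have h0 : Tendsto (fun u : ℝ => |u|⁻¹) l (𝓝 0) := tendsto_inv_atTop_zero.comp hl
  have hpos : ∀ᶠ u in l, 0 < |u| := hl.eventually_gt_atTop 0
  constructor
  · refine squeeze_zero_norm' ?_ h0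
    filter_upwards [hpos] with u hu
    rw [Real.norm_eq_abs, abs_div, abs_of_pos (show (0:ℝ) < 1 + u ^ 2 by positivity),
      div_le_iff₀ (by positivity), ← sq_abs u]
    field_simp
    nlinarith
  · refine squeeze_zero_norm' ?_ h0
    filter_upwards [hpos] with u hu
    rw [Real.norm_eq_abs, abs_div, abs_of_pos (show (0:ℝ) < 1 + u ^ 2 by positivity),
      div_le_iff₀ (by positivity), ← sq_abs u, abs_one]
    field_simp
    nlinarith [sq_nonneg (|u| - 1)]

/-- antiderivative tends to zero -/
lemma tendsto_log_aux (x : ℝ) (l : Filter ℝ) (hl : Tendsto (fun u : ℝ => |u|) l atTop) :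
    Tendsto (fun u : ℝ => 1 / 2 * Real.log (1 + (x + u) ^ 2) - 1 / 2 * Real.log (1 + u ^ 2))
      l (𝓝 0) := by
  obtain ⟨h1, h2⟩ := tendsto_aux_div l hl
  have h3 : Tendsto (fun u : ℝ => 1 + x ^ 2 * (1 / (1 + u ^ 2)) + 2 * x * (u / (1 + u ^ 2))) l
      (𝓝 (1 + x ^ 2 * 0 + 2 * x * 0)) :=
    (tendsto_const_nhds.add (h2.const_mul _)).add (h1.const_mul _)
  have h4 := (h3.log (by norm_num)).const_mul (1 / 2)
  simp only [mul_zero, add_zero, Real.log_one] at h4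
  refine h4.congr fun u => ?_
  have e : 1 + x ^ 2 * (1 / (1 + u ^ 2)) + 2 * x * (u / (1 + u ^ 2))
      = (1 + (x + u) ^ 2) / (1 + u ^ 2) := by
    field_simp
    ring
  rw [e, Real.log_div (by positivity) (by positivity)]
  ring

lemma integrable_B (x : ℝ) :
    Integrable (fun u : ℝ => (x + u) / (1 + (x + u) ^ 2) - u / (1 + u ^ 2)) := by
  refine (integrable_inv_one_add_sq.const_mul (|x| + x ^ 2)).mono' ?_ ?_
  · refine Continuous.aestronglyMeasurable ?_
    refine Continuous.sub (Continuous.div (by fun_prop) (by fun_prop) fun u => by positivity)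
      (Continuous.div (by fun_prop) (by fun_prop) fun u => by positivity)
  · refine Eventually.of_forall fun u => ?_
    have e : (x + u) / (1 + (x + u) ^ 2) - u / (1 + u ^ 2)
        = ((x - x * (x + u) ^ 2 + x ^ 2 * (x + u)) / (1 + (x + u) ^ 2)) * (1 + u ^ 2)⁻¹ := by
      field_simp
      ring
    rw [Real.norm_eq_abs, e, abs_mul, abs_of_pos (show (0:ℝ) < (1 + u ^ 2)⁻¹ by positivity)]
    refine mul_le_mul_of_nonneg_right ?_ (by positivity)
    rw [abs_div, abs_of_pos (show (0:ℝ) < 1 + (x + u) ^ 2 by positivity),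
      div_le_iff₀ (by positivity)]
    generalize x + u = v
    have hx := neg_abs_le x
    have hx' := le_abs_self x
    rw [abs_le]
    constructor <;>
      nlinarith [mul_nonneg (sq_nonneg x) (sq_nonneg (v - 1)),
        mul_nonneg (sq_nonneg x) (sq_nonneg (v + 1)), sq_nonneg v, sq_nonneg x,
        mul_nonneg (sub_nonneg.2 hx') (sq_nonneg v), mul_nonneg (sq_nonneg x) (sq_nonneg v),
        mul_nonneg (neg_le_iff_add_nonneg.1 hx) (sq_nonneg v)]

lemma integral_B (x : ℝ) :
    ∫ u : ℝ, ((x + u) / (1 + (x + u) ^ 2) - u / (1 + u ^ 2)) = 0 := by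
  have := integral_of_hasDerivAt_of_tendsto
    (f := fun u : ℝ => 1 / 2 * Real.log (1 + (x + u) ^ 2) - 1 / 2 * Real.log (1 + u ^ 2))
    (f' := fun u : ℝ => (x + u) / (1 + (x + u) ^ 2) - u / (1 + u ^ 2)) ?_ (integrable_B x)
    (tendsto_log_aux x _ tendsto_abs_atBot_atTop) (tendsto_log_aux x _ tendsto_abs_atTop_atTop)
  · simpa using this
  · intro u
    have a1 : HasDerivAt (fun u : ℝ => 1 + (x + u) ^ 2) (2 * (x + u)) u := by
      have := (((hasDerivAt_id u).const_add x).pow 2).const_add 1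
      exact this.congr_deriv (by simp)
    have a2 : HasDerivAt (fun u : ℝ => 1 + u ^ 2) (2 * u) u := by
      have := ((hasDerivAt_id u).pow 2).const_add 1
      exact this.congr_deriv (by simp)
    have := ((a1.log (by positivity)).const_mul (1 / 2)).sub
      ((a2.log (by positivity)).const_mul (1 / 2))
    exact this.congr_deriv (by ring)

def kAux (u : ℝ) : ℝ := (if |u| ≤ 1 then 0 else 1 / u) - u / (1 + u ^ 2)

lemma integrable_kAux : Integrable kAux := by
  refine integrable_inv_one_add_sq.mono' ?_ ?_
  · refine Measurable.aestronglyMeasurable ?_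
    unfold kAux
    refine Measurable.sub (Measurable.ite ?_ measurable_const (by fun_prop)) (by fun_prop)
    exact measurableSet_le (by fun_prop) measurable_const
  · refine Eventually.of_forall fun u => ?_
    unfold kAux
    rw [Real.norm_eq_abs]
    split_ifs with h
    · rw [zero_sub, abs_neg, abs_div, abs_of_pos (show (0:ℝ) < 1 + u ^ 2 by positivity),
        inv_eq_one_div]
      gcongr
    · push Not at h
      have hu : u ≠ 0 := by
        rintro rfl
        norm_num at h
      have : 1 / u - u / (1 + u ^ 2) = u⁻¹ * (1 + u ^ 2)⁻¹ := by
        field_simp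
        ring
      rw [this, abs_mul, abs_of_pos (show (0:ℝ) < (1 + u ^ 2)⁻¹ by positivity), abs_inv]
      exact mul_le_of_le_one_left (by positivity) (inv_le_one_of_one_le₀ h.le)

lemma integral_kAux : ∫ u, kAux u = 0 := by
  have h1 : ∫ u, kAux (-u) = ∫ u, kAux u := integral_neg_eq_self kAux volume
  have h2 : ∀ u, kAux (-u) = - kAux u := by
    intro u
    unfold kAux
    rw [abs_neg]
    split_ifs <;> simp <;> ring
  simp only [h2, integral_neg] at h1
  linarith

lemma hasDerivAt_cauchy (x : ℝ) :
    HasDerivAt cauchyDens (-(2 * x) / (π * (1 + x ^ 2) ^ 2)) x := by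
  have a2 : HasDerivAt (fun u : ℝ => π * (1 + u ^ 2)) (π * (2 * x)) x := by
    have := (((hasDerivAt_id x).pow 2).const_add 1).const_mul π
    exact this.congr_deriv (by simp)
  have := (hasDerivAt_const x (1:ℝ)).div a2 (by positivity)
  refine this.congr_deriv ?_
  field_simp
  ring

lemma Lop1_cauchy (x : ℝ) :
    Lop1 cauchyDens x = (x ^ 2 - 1) / (π * (1 + x ^ 2) ^ 2) := by
  unfold Lop1
  rw [(hasDerivAt_cauchy x).deriv]
  have iA : Integrable (fun u : ℝ => (1 + (x + u) ^ 2)⁻¹) :=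
    integrable_inv_one_add_sq.comp_add_left x
  have vA : ∫ u : ℝ, (1 + (x + u) ^ 2)⁻¹ = π := by
    rw [integral_add_left_eq_self (fun u : ℝ => (1 + u ^ 2)⁻¹) x, integral_univ_inv_one_add_sq]
  have key : (fun u : ℝ => (cauchyDens (x + u) - cauchyDens x -
      (if |u| ≤ 1 then u * (-(2 * x) / (π * (1 + x ^ 2) ^ 2)) else 0)) * (1 / (π * u ^ 2)))
      =ᵐ[volume] fun u => 1 / (π ^ 2 * (1 + x ^ 2) ^ 2) * ((x ^ 2 - 1) * (1 + (x + u) ^ 2)⁻¹ +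
        2 * x * ((x + u) / (1 + (x + u) ^ 2) - u / (1 + u ^ 2)) - 2 * x * kAux u) := by
    have : ∀ᵐ u : ℝ ∂volume, u ≠ 0 := by
      simp [ae_iff]
    filter_upwards [this] with u hu
    unfold cauchyDens kAux
    have hx : (1 + x ^ 2) ≠ 0 := by positivity
    have hxu : (1 + (x + u) ^ 2) ≠ 0 := by positivity
    have huu : (1 + u ^ 2) ≠ 0 := by positivity
    split_ifs
    · field_simp
      ring
    · field_simp
      ring
  rw [integral_congr_ae key, integral_const_mul, integral_sub, integral_add, integral_const_mul,
    integral_const_mul, integral_const_mul, vA, integral_B, integral_kAux]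
  · field_simp
    ring
  · exact iA.const_mul _
  · exact (integrable_B x).const_mul _
  · exact (iA.const_mul _).add ((integrable_B x).const_mul _)
  · exact integrable_kAux.const_mul _

lemma Lop1_bound (x : ℝ) : |Lop1 cauchyDens x| ≤ (1 + x ^ 2)⁻¹ := by
  rw [Lop1_cauchy, abs_div, abs_of_pos (show 0 < π * (1 + x ^ 2) ^ 2 by positivity),
    div_le_iff₀ (by positivity)]
  have e : (1 + x ^ 2)⁻¹ * (π * (1 + x ^ 2) ^ 2) = π * (1 + x ^ 2) := by
    field_simp
  rw [e, abs_le]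
  have := Real.pi_gt_three
  constructor <;> nlinarith [sq_nonneg x]

lemma continuous_Lop1 : Continuous (Lop1 cauchyDens) := by
  rw [funext Lop1_cauchy]
  exact Continuous.div (by fun_prop) (by fun_prop) fun u => by positivity

lemma integrable_Lop1 : Integrable (Lop1 cauchyDens) :=
  integrable_inv_one_add_sq.mono' continuous_Lop1.aestronglyMeasurable
    (Eventually.of_forall Lop1_bound)

lemma integral_Lop1 : ∫ x, Lop1 cauchyDens x = 0 := by
  have ht : ∀ l : Filter ℝ, Tendsto (fun u : ℝ => |u|) l atTop →
      Tendsto (fun u : ℝ => -(1 / π) * (u / (1 + u ^ 2))) l (𝓝 0) := by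
    intro l hl
    simpa using (tendsto_aux_div l hl).1.const_mul (-(1 / π))
  have := integral_of_hasDerivAt_of_tendsto
    (f := fun u : ℝ => -(1 / π) * (u / (1 + u ^ 2)))
    (f' := Lop1 cauchyDens) ?_ integrable_Lop1
    (ht _ tendsto_abs_atBot_atTop) (ht _ tendsto_abs_atTop_atTop)
  · simpa using this
  · intro u
    have a2 : HasDerivAt (fun u : ℝ => 1 + u ^ 2) (2 * u) u := by
      have := ((hasDerivAt_id u).pow 2).const_add 1
      exact this.congr_deriv (by simp)
    have := ((hasDerivAt_id u).div a2 (by positivity)).const_mul (-(1 / π))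
    refine this.congr_deriv ?_
    rw [Lop1_cauchy]
    simp only [id]
    field_simp
    ring

/-- Lemma 3.5 (2): `|∫ (L^{1,0} p)(y) h(ay) dy| ≤ C_β (a^β + a)` for the Cauchy density. -/
theorem Lop_density_pairing_bound_cauchy :
    ∀ β : ℝ, 0 < β → β < 1 → ∃ C > 0,
      ∀ h : ℝ → ℝ, memHbeta β h → ∀ a : ℝ, 0 < a →
        |∫ y, Lop1 cauchyDens y * h (a * y)| ≤ C * (a ^ β + a) := by
  intro β hβ hβ1
  have iG : Integrable (fun y : ℝ => (1 + ‖y‖ ^ 2) ^ (-(2 - β) / 2)) := by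
    apply integrable_rpow_neg_one_add_norm_sq
    simp
    linarith
  set I := ∫ y : ℝ, (1 + ‖y‖ ^ 2) ^ (-(2 - β) / 2) with hI
  have hI0 : 0 ≤ I := integral_nonneg fun y => by positivity
  refine ⟨I + 1, by positivity, fun h hh a ha => ?_⟩
  have hcont : Continuous h := by
    have : LipschitzWith 1 h := LipschitzWith.of_dist_le_mul fun x y => by
      simpa [Real.dist_eq] using (hh x y).trans (min_le_left _ _)
    exact this.continuous
  have hb : ∀ y : ℝ, ‖Lop1 cauchyDens y * (h (a * y) - h 0)‖ ≤
      a ^ β * (1 + ‖y‖ ^ 2) ^ (-(2 - β) / 2) := by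
    intro y
    have h1 : |h (a * y) - h 0| ≤ a ^ β * |y| ^ β := by
      have := (hh (a * y) 0).trans (min_le_right _ _)
      rwa [sub_zero, abs_mul, abs_of_pos ha, Real.mul_rpow ha.le (abs_nonneg y)] at this
    have h2 : |y| ^ β ≤ (1 + y ^ 2) ^ (β / 2) := by
      have : |y| ^ β = (y ^ 2) ^ (β / 2) := by
        rw [← sq_abs, ← Real.rpow_natCast, ← Real.rpow_mul (abs_nonneg y)]
        congr 1
        push_cast
        ring
      rw [this]
      apply Real.rpow_le_rpow <;> [positivity; linarith; linarith]
    rw [norm_mul, Real.norm_eq_abs, Real.norm_eq_abs, Real.norm_eq_abs, sq_abs]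
    calc |Lop1 cauchyDens y| * |h (a * y) - h 0|
        ≤ (1 + y ^ 2)⁻¹ * (a ^ β * (1 + y ^ 2) ^ (β / 2)) := by
          refine mul_le_mul (Lop1_bound y) (h1.trans ?_) (abs_nonneg _) (by positivity)
          gcongr
      _ = a ^ β * (1 + y ^ 2) ^ (-(2 - β) / 2) := by
          have : -(2 - β) / 2 = -1 + β / 2 := by ring
          rw [this, Real.rpow_add (by positivity), Real.rpow_neg_one]
          ring
  have iD : Integrable (fun y => Lop1 cauchyDens y * (h (a * y) - h 0)) := by
    refine (iG.const_mul (a ^ β)).mono' ?_ (Eventually.of_forall hb)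
    exact (continuous_Lop1.mul (by fun_prop)).aestronglyMeasurable
  have e : ∫ y, Lop1 cauchyDens y * h (a * y) =
      ∫ y, Lop1 cauchyDens y * (h (a * y) - h 0) := by
    have : ∀ y, Lop1 cauchyDens y * h (a * y) =
        Lop1 cauchyDens y * (h (a * y) - h 0) + Lop1 cauchyDens y * h 0 := fun y => by ring
    simp_rw [this]
    rw [integral_add iD (integrable_Lop1.mul_const _), integral_mul_const, integral_Lop1]
    ring
  rw [e, ← Real.norm_eq_abs]
  have h3 := norm_integral_le_of_norm_le (iG.const_mul (a ^ β)) (Eventually.of_forall hb)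
  rw [integral_const_mul, ← hI] at h3
  have := Real.rpow_nonneg ha.le β
  nlinarith [mul_nonneg hI0 ha.le]
end
end
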